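/- For every x > 0 the Bateman functions of even integer order have the closed forms: k_0(x) = e^{−x}, k_2(x) = 2x e^{−x}, k_4(x) = 2x(x−1) e^{−x}, and k_6(x) = (2/3) x (2x² − 6x + 3) e^{−x}. -/

import Mathlib

/-- The Bateman function `k_ν(x) = (2/π) ∫₀^{π/2} cos(x·tan θ − ν·θ) dθ`. -/
noncomputable def batemanK (ν x : ℝ) : ℝ :=
  (2 / Real.pi) * ∫ θ in (0:ℝ)..(Real.pi / 2), Real.cos (x * Real.tan θ - ν * θ)

open Real Set Filter Topology MeasureTheory intervalIntegral

theorem intervalIntegrable_of_abs_le_one {f : ℝ → ℝ} (hf : Measurable f) (hb : ∀ t, |f t| ≤ 1)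
    (a b : ℝ) : IntervalIntegrable f volume a b := by
  refine (intervalIntegrable_const (c := (1 : ℝ))).mono_fun hf.aestronglyMeasurable ?_
  exact Eventually.of_forall fun t => by simpa using hb t

theorem measurable_real_tan : Measurable Real.tan := by
  have : Real.tan = fun t => Real.sin t / Real.cos t := funext Real.tan_eq_sin_div_cos
  rw [this]
  exact Real.measurable_sin.div Real.measurable_cos

/-- The integral defining the Bateman function, without its normalising factor. -/
noncomputable def batemanIntegral (ν x : ℝ) : ℝ :=
  ∫ θ in (0:ℝ)..(π / 2), cos (x * tan θ - ν * θ)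

theorem intervalIntegrable_bateman (ν x : ℝ) :
    IntervalIntegrable (fun θ => cos (x * tan θ - ν * θ)) volume 0 (π / 2) := by
  refine intervalIntegrable_of_abs_le_one ?_ (fun t => abs_cos_le_one _) _ _
  have := measurable_real_tan
  fun_prop

theorem continuousOn_cos_sq_mul_sin (ν x : ℝ) :
    ContinuousOn (fun θ => cos θ ^ 2 * sin (x * tan θ - ν * θ)) (Icc 0 (π / 2)) := by
  intro t ht
  have hpi := pi_pos
  apply ContinuousAt.continuousWithinAt
  by_cases hc : cos t = 0
  · have h0 : Tendsto (fun θ => cos θ ^ 2) (𝓝 t) (𝓝 0) := by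
      have : ContinuousAt (fun θ => cos θ ^ 2) t := by fun_prop
      simpa [ContinuousAt, hc] using this
    simp only [ContinuousAt, hc]
    simp only [ne_eq, OfNat.ofNat_ne_zero, not_false_eq_true, zero_pow, zero_mul]
    refine squeeze_zero_norm (fun θ => ?_) h0
    rw [norm_mul, norm_of_nonneg (sq_nonneg _)]
    exact mul_le_of_le_one_right (sq_nonneg _) (abs_sin_le_one _)
  · have := continuousAt_tan.2 hc
    fun_prop

/-- Three-term recurrence in the order. -/
theorem batemanIntegral_recurrence (ν x : ℝ) :
    (ν + 2) * batemanIntegral (ν + 2) x =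
      (4 * x - 2 * ν) * batemanIntegral ν x + (2 - ν) * batemanIntegral (ν - 2) x := by
  have i1 := (intervalIntegrable_bateman (ν + 2) x).const_mul (-(ν + 2) / 4)
  have i2 := (intervalIntegrable_bateman ν x).const_mul (x - ν / 2)
  have i3 := (intervalIntegrable_bateman (ν - 2) x).const_mul ((2 - ν) / 4)
  have key := integral_eq_sub_of_hasDerivAt_of_le (by positivity)
    (continuousOn_cos_sq_mul_sin ν x) (f' := fun θ =>
      -(ν + 2) / 4 * cos (x * tan θ - (ν + 2) * θ) + (x - ν / 2) * cos (x * tan θ - ν * θ)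
        + (2 - ν) / 4 * cos (x * tan θ - (ν - 2) * θ)) ?_ ((i1.add i2).add i3)
  · rw [integral_add (i1.add i2) i3, integral_add i1 i2, intervalIntegral.integral_const_mul, intervalIntegral.integral_const_mul,
      intervalIntegral.integral_const_mul] at key
    simp only [cos_pi_div_two, tan_zero, mul_zero, sub_zero, sin_zero] at key
    unfold batemanIntegral
    linarith
  · intro t ht
    have hc : cos t ≠ 0 := (cos_pos_of_mem_Ioo ⟨by linarith [ht.1, pi_pos], ht.2⟩).ne'
    have h := ((hasDerivAt_cos t).pow 2).mul
      ((((hasDerivAt_tan hc).const_mul x).sub ((hasDerivAt_id t).const_mul ν)).sin)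
    refine h.congr_deriv ?_
    have e1 : x * tan t - (ν + 2) * t = (x * tan t - ν * t) - 2 * t := by ring
    have e2 : x * tan t - (ν - 2) * t = (x * tan t - ν * t) + 2 * t := by ring
    rw [e1, e2, cos_sub _ (2 * t), cos_add _ (2 * t), sin_two_mul, cos_two_mul]
    simp
    field_simp
    ring

/-- The auxiliary integral `∫ cos² θ cos (x tan θ)`. -/
noncomputable def batemanAux (x : ℝ) : ℝ :=
  ∫ θ in (0:ℝ)..(π / 2), cos θ ^ 2 * cos (x * tan θ)

/-- The derivative of `batemanAux`. -/
noncomputable def batemanAuxDeriv (x : ℝ) : ℝ :=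
  ∫ θ in (0:ℝ)..(π / 2), -(sin θ * cos θ * sin (x * tan θ))

theorem abs_mul_le_one_of_le_one {a b : ℝ} (ha : |a| ≤ 1) (hb : |b| ≤ 1) : |a * b| ≤ 1 := by
  rw [abs_mul]
  exact mul_le_one₀ ha (abs_nonneg _) hb

theorem abs_batemanAux_integrand_le (x t : ℝ) : |cos t ^ 2 * cos (x * tan t)| ≤ 1 := by
  rw [pow_two]
  exact abs_mul_le_one_of_le_one
    (abs_mul_le_one_of_le_one (abs_cos_le_one _) (abs_cos_le_one _)) (abs_cos_le_one _)

theorem abs_batemanAuxDeriv_integrand_le (x t : ℝ) :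
    |-(sin t * cos t * sin (x * tan t))| ≤ 1 := by
  rw [abs_neg]
  exact abs_mul_le_one_of_le_one
    (abs_mul_le_one_of_le_one (abs_sin_le_one _) (abs_cos_le_one _)) (abs_sin_le_one _)

theorem intervalIntegrable_batemanAux (x : ℝ) :
    IntervalIntegrable (fun θ => cos θ ^ 2 * cos (x * tan θ)) volume 0 (π / 2) := by
  have := measurable_real_tan
  exact intervalIntegrable_of_abs_le_one (by fun_prop) (abs_batemanAux_integrand_le x) _ _

theorem intervalIntegrable_batemanAuxDeriv (x : ℝ) :
    IntervalIntegrable (fun θ => -(sin θ * cos θ * sin (x * tan θ))) volume 0 (π / 2) := by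
  have := measurable_real_tan
  exact intervalIntegrable_of_abs_le_one (by fun_prop) (abs_batemanAuxDeriv_integrand_le x) _ _

theorem ae_cos_ne_zero_of_mem_uIoc :
    ∀ᵐ t ∂volume, t ∈ uIoc 0 (π / 2) → cos t ≠ 0 := by
  have h : ∀ᵐ t : ℝ ∂volume, t ≠ π / 2 := by simp [ae_iff]
  filter_upwards [h] with t ht hm
  rw [uIoc_of_le (by positivity)] at hm
  exact (cos_pos_of_mem_Ioo ⟨by linarith [hm.1, pi_pos], lt_of_le_of_ne hm.2 ht⟩).ne'

theorem hasDerivAt_batemanAux (x : ℝ) : HasDerivAt batemanAux (batemanAuxDeriv x) x := by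
  have hm := measurable_real_tan
  refine (hasDerivAt_integral_of_dominated_loc_of_deriv_le (bound := fun _ => 1)
    (F' := fun x θ => -(sin θ * cos θ * sin (x * tan θ))) univ_mem
    (Eventually.of_forall fun y => ?_) (intervalIntegrable_batemanAux x) ?_ ?_ ?_ ?_).2
  · exact (show Measurable fun θ => cos θ ^ 2 * cos (y * tan θ) by fun_prop).aestronglyMeasurable
  · exact (show Measurable fun θ => -(sin θ * cos θ * sin (x * tan θ)) by
      fun_prop).aestronglyMeasurable
  · exact Eventually.of_forall fun t _ y _ => abs_batemanAuxDeriv_integrand_le y t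
  · exact intervalIntegrable_const
  · filter_upwards [ae_cos_ne_zero_of_mem_uIoc] with t ht hmem y _
    have h := (((hasDerivAt_id y).mul_const (tan t)).cos).const_mul (cos t ^ 2)
    refine h.congr_deriv ?_
    have hc := ht hmem
    simp only [id, ← tan_mul_cos hc]
    ring

theorem hasDerivAt_batemanAuxDeriv (x : ℝ) :
    HasDerivAt batemanAuxDeriv (batemanAux x - batemanIntegral 0 x) x := by
  have hm := measurable_real_tan
  have e : batemanAux x - batemanIntegral 0 x =
      ∫ θ in (0:ℝ)..(π / 2), -(sin θ * sin θ * cos (x * tan θ)) := by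
    unfold batemanAux batemanIntegral
    rw [← integral_sub (intervalIntegrable_batemanAux x) (intervalIntegrable_bateman 0 x)]
    refine integral_congr fun t _ => ?_
    simp only [zero_mul, sub_zero]
    linear_combination cos (x * tan t) * sin_sq_add_cos_sq t
  rw [e]
  refine (hasDerivAt_integral_of_dominated_loc_of_deriv_le (bound := fun _ => 1)
    (F' := fun x θ => -(sin θ * sin θ * cos (x * tan θ))) univ_mem
    (Eventually.of_forall fun y => ?_) (intervalIntegrable_batemanAuxDeriv x) ?_ ?_ ?_ ?_).2
  · exact (show Measurable fun θ => -(sin θ * cos θ * sin (y * tan θ)) by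
      fun_prop).aestronglyMeasurable
  · exact (show Measurable fun θ => -(sin θ * sin θ * cos (x * tan θ)) by
      fun_prop).aestronglyMeasurable
  · refine Eventually.of_forall fun t _ y _ => ?_
    rw [norm_neg]
    exact abs_mul_le_one_of_le_one
      (abs_mul_le_one_of_le_one (abs_sin_le_one _) (abs_sin_le_one _)) (abs_cos_le_one _)
  · exact intervalIntegrable_const
  · filter_upwards [ae_cos_ne_zero_of_mem_uIoc] with t ht hmem y _
    have h := ((((hasDerivAt_id y).mul_const (tan t)).sin).const_mul (sin t * cos t)).neg
    refine h.congr_deriv ?_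
    have hc := ht hmem
    simp only [id]
    linear_combination -sin t * cos (y * tan t) * tan_mul_cos hc

theorem abs_batemanAux_le (x : ℝ) : |batemanAux x| ≤ π / 2 := by
  have h := norm_integral_le_of_norm_le_const (a := 0) (b := π / 2) (C := 1)
    (f := fun θ => cos θ ^ 2 * cos (x * tan θ)) (fun t _ => abs_batemanAux_integrand_le x t)
  rw [sub_zero, abs_of_pos (by positivity), one_mul] at h
  exact h

theorem abs_batemanAuxDeriv_le (x : ℝ) : |batemanAuxDeriv x| ≤ π / 2 := by
  have h := norm_integral_le_of_norm_le_const (a := 0) (b := π / 2) (C := 1)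
    (f := fun θ => -(sin θ * cos θ * sin (x * tan θ)))
    (fun t _ => abs_batemanAuxDeriv_integrand_le x t)
  rw [sub_zero, abs_of_pos (by positivity), one_mul] at h
  exact h

theorem batemanAux_zero : batemanAux 0 = π / 4 := by
  simp only [batemanAux, zero_mul, cos_zero, mul_one, integral_cos_sq]
  simp
  ring

theorem batemanIntegral_two_sub (x : ℝ) :
    batemanIntegral 2 x - batemanIntegral (-2) x = -4 * batemanAuxDeriv x := by
  unfold batemanIntegral batemanAuxDeriv
  rw [← integral_sub (intervalIntegrable_bateman _ x) (intervalIntegrable_bateman _ x),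
    ← intervalIntegral.integral_const_mul]
  refine integral_congr fun t _ => ?_
  simp only [neg_mul, sub_neg_eq_add]
  rw [cos_sub, cos_add, sin_two_mul]
  ring

theorem batemanIntegral_zero_add (x : ℝ) :
    batemanIntegral 0 x + batemanIntegral (-2) x = 2 * (batemanAux x + batemanAuxDeriv x) := by
  unfold batemanIntegral batemanAuxDeriv batemanAux
  rw [← integral_add (intervalIntegrable_bateman _ x) (intervalIntegrable_bateman _ x),
    ← integral_add (intervalIntegrable_batemanAux x) (intervalIntegrable_batemanAuxDeriv x),
    ← intervalIntegral.integral_const_mul]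
  refine integral_congr fun t _ => ?_
  simp only [neg_mul, sub_neg_eq_add, zero_mul, sub_zero]
  rw [cos_add, sin_two_mul, cos_two_mul]
  ring

theorem batemanAuxDeriv_eq (x : ℝ) : 2 * batemanAuxDeriv x = -(x * batemanIntegral 0 x) := by
  have h := batemanIntegral_recurrence 0 x
  simp only [zero_add, zero_sub] at h
  linarith [batemanIntegral_two_sub x]

theorem eq_of_hasDerivAt_zero_Ioi {f : ℝ → ℝ} (hf : ∀ x > 0, HasDerivAt f 0 x) {x y : ℝ}
    (hx : 0 < x) (hy : 0 < y) : f x = f y := by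
  refine (convex_Ioi (0 : ℝ)).is_const_of_fderivWithin_eq_zero (𝕜 := ℝ)
    (fun z hz => (hf z hz).differentiableAt.differentiableWithinAt) (fun z hz => ?_) hx hy
  rw [fderivWithin_of_isOpen isOpen_Ioi hz]
  simpa using (hf z hz).hasFDerivAt.fderiv

/-- The coefficient of the growing solution of the differential equation vanishes. -/
theorem batemanAux_first_order {x : ℝ} (hx : 0 < x) :
    (1 + x) * batemanAuxDeriv x + x * batemanAux x = 0 := by
  set f : ℝ → ℝ := fun y =>
    exp (-y) * ((1 + y) * batemanAuxDeriv y + y * batemanAux y) / y ^ 2 with hf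
  have hd : ∀ y > 0, HasDerivAt f 0 y := by
    intro y hy
    have h := (((hasDerivAt_id y).neg.exp).mul
      ((((hasDerivAt_id y).const_add 1).mul (hasDerivAt_batemanAuxDeriv y)).add
        ((hasDerivAt_id y).mul (hasDerivAt_batemanAux y)))).div
      ((hasDerivAt_id y).pow 2) (by simp; positivity)
    refine h.congr_deriv ?_
    have hk : batemanIntegral 0 y = -(2 * batemanAuxDeriv y) / y := by
      rw [batemanAuxDeriv_eq]; field_simp
    simp [hk]
    left
    field_simp
    ring
  have hlim : Tendsto f atTop (𝓝 0) := by
    have hb : Tendsto (fun y : ℝ => 3 * (π / 2) * exp (-y)) atTop (𝓝 0) := by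
      simpa using (tendsto_exp_neg_atTop_nhds_zero).const_mul (3 * (π / 2))
    refine squeeze_zero_norm' ?_ hb
    filter_upwards [eventually_ge_atTop 1] with y hy
    have h1 := abs_batemanAux_le y
    have h2 := abs_batemanAuxDeriv_le y
    rw [norm_eq_abs, hf, abs_div, abs_mul, abs_of_pos (exp_pos _), abs_of_nonneg (sq_nonneg y),
      div_le_iff₀ (by positivity)]
    have h3 : |(1 + y) * batemanAuxDeriv y + y * batemanAux y| ≤ 3 * (π / 2) * y ^ 2 := by
      refine (abs_add_le _ _).trans ?_
      rw [abs_mul, abs_mul, abs_of_pos (by linarith : 0 < 1 + y), abs_of_pos (by linarith : 0 < y)]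
      have hpi := pi_pos
      have h4 : (1 + y) * |batemanAuxDeriv y| ≤ (1 + y) * (π / 2) := by gcongr
      have h5 : y * |batemanAux y| ≤ y * (π / 2) := by gcongr
      have h6 : 1 + 2 * y ≤ 3 * y ^ 2 := by nlinarith
      have h7 := mul_le_mul_of_nonneg_right h6 (by positivity : 0 ≤ π / 2)
      linarith
    calc _ ≤ exp (-y) * (3 * (π / 2) * y ^ 2) := by gcongr
      _ = _ := by ring
  have hconst : Tendsto f atTop (𝓝 (f x)) := by
    refine tendsto_const_nhds.congr' ?_
    filter_upwards [eventually_gt_atTop 0] with y hy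
    exact eq_of_hasDerivAt_zero_Ioi hd hx hy
  have h0 : f x = 0 := tendsto_nhds_unique hconst hlim
  simpa [hf, hx.ne', (exp_pos _).ne'] using h0

theorem batemanAux_eq {x : ℝ} (hx : 0 < x) : batemanAux x = π / 4 * ((1 + x) * exp (-x)) := by
  set f : ℝ → ℝ := fun y => exp y * batemanAux y / (1 + y) with hf
  have hd : ∀ y > 0, HasDerivAt f 0 y := by
    intro y hy
    have hy1 : 1 + y ≠ 0 := by positivity
    have h := ((hasDerivAt_exp y).mul (hasDerivAt_batemanAux y)).div
      ((hasDerivAt_id y).const_add 1) hy1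
    refine h.congr_deriv ?_
    have := batemanAux_first_order hy
    simp only [id]
    rw [div_eq_zero_iff]
    left
    simp
    linear_combination exp y * this
  have hlim : Tendsto f (𝓝[>] 0) (𝓝 (π / 4)) := by
    have hc : ContinuousAt f 0 :=
      (continuous_exp.continuousAt.mul (hasDerivAt_batemanAux 0).continuousAt).div
        (by fun_prop) (by simp)
    have h0 : f 0 = π / 4 := by simp [hf, batemanAux_zero]
    rw [← h0]
    exact hc.tendsto.mono_left nhdsWithin_le_nhds
  have hconst : Tendsto f (𝓝[>] 0) (𝓝 (f x)) := by
    refine tendsto_const_nhds.congr' ?_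
    filter_upwards [self_mem_nhdsWithin] with y hy
    exact eq_of_hasDerivAt_zero_Ioi hd hx hy
  have h0 := tendsto_nhds_unique hconst hlim
  have hx1 : 1 + x ≠ 0 := by positivity
  rw [exp_neg]
  simp only [hf] at h0
  field_simp at h0 ⊢
  linarith

theorem batemanAuxDeriv_closed {x : ℝ} (hx : 0 < x) :
    batemanAuxDeriv x = -(π / 4 * (x * exp (-x))) := by
  have h := batemanAux_first_order hx
  rw [batemanAux_eq hx] at h
  have hx1 : 1 + x ≠ 0 := by positivity
  apply mul_left_cancel₀ hx1
  linarith

theorem batemanIntegral_zero {x : ℝ} (hx : 0 < x) : batemanIntegral 0 x = π / 2 * exp (-x) := by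
  have h := batemanAuxDeriv_eq x
  rw [batemanAuxDeriv_closed hx] at h
  apply mul_left_cancel₀ hx.ne'
  linarith

theorem batemanIntegral_neg_two {x : ℝ} (hx : 0 < x) : batemanIntegral (-2) x = 0 := by
  have h := batemanIntegral_zero_add x
  rw [batemanAuxDeriv_closed hx, batemanAux_eq hx, batemanIntegral_zero hx] at h
  linarith

theorem bateman_closed_forms (x : ℝ) (hx : 0 < x) :
    batemanK 0 x = Real.exp (-x) ∧
    batemanK 2 x = 2 * x * Real.exp (-x) ∧
    batemanK 4 x = 2 * x * (x - 1) * Real.exp (-x) ∧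
    batemanK 6 x = (2 / 3) * x * (2 * x ^ 2 - 6 * x + 3) * Real.exp (-x) := by
  have h0 := batemanIntegral_zero hx
  have h2 : batemanIntegral 2 x = π / 2 * (2 * x * exp (-x)) := by
    have h := batemanIntegral_recurrence 0 x
    simp only [zero_add, zero_sub, batemanIntegral_neg_two hx, h0] at h
    linarith
  have h4 : batemanIntegral 4 x = π / 2 * (2 * x * (x - 1) * exp (-x)) := by
    have h := batemanIntegral_recurrence 2 x
    norm_num [h0, h2] at h
    linarith
  have h6 : batemanIntegral 6 x =
      π / 2 * ((2 / 3) * x * (2 * x ^ 2 - 6 * x + 3) * exp (-x)) := by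
    have h := batemanIntegral_recurrence 4 x
    norm_num [h2, h4] at h
    linarith
  have hK : ∀ ν c, batemanIntegral ν x = π / 2 * c → batemanK ν x = c := by
    intro ν c h
    change 2 / π * batemanIntegral ν x = c
    rw [h]
    field_simp
  exact ⟨hK _ _ h0, hK _ _ h2, hK _ _ h4, hK _ _ h6⟩
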